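/- arXiv:1806.01635 — 2 statements merged into one kernel-verified Lean document; each statement's English description precedes it below -/
import Mathlib

section
/- Let ω = (ω₁, ω₂) be irrational and k ∈ ℤ². Then for every triple (k₁, k₂, k₃) ∈ R(k) there exists an index i ∈ {1, 2, 3} such that max(|k_i⁽¹⁾|, |k_i⁽²⁾|) ≥ max(|k⁽¹⁾|, |k⁽²⁾|). In particular, if k ∉ Q_M, then every triple in R(k) contains an element not belonging to Q_M. -/
/-- `ω = (ω₁, ω₂)` is irrational: `ω₁m₁ + ω₂m₂ ≠ 0` for every nonzero `(m₁, m₂) ∈ ℤ²`. -/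
def IsIrrationalPair (ω : ℝ × ℝ) : Prop :=
  ∀ m : ℤ × ℤ, m ≠ 0 → ω.1 * (m.1 : ℝ) + ω.2 * (m.2 : ℝ) ≠ 0

/-- The frequency `λ_k = ω₁(k⁽¹⁾)² + ω₂(k⁽²⁾)²` for `k ∈ ℤ²`. -/
noncomputable def freq (ω : ℝ × ℝ) (k : ℤ × ℤ) : ℝ :=
  ω.1 * (k.1 : ℝ) ^ 2 + ω.2 * (k.2 : ℝ) ^ 2

/-- Membership in the resonance set `R`. -/
def InRes (ω : ℝ × ℝ) (k₁ k₂ k₃ k₄ : ℤ × ℤ) : Prop :=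
  k₁ + k₂ = k₃ + k₄ ∧ freq ω k₁ + freq ω k₂ = freq ω k₃ + freq ω k₄

/-- `(k₁, k₂, k₃) ∈ R(k)` iff `(k₁, k₂, k₃, k) ∈ R`. -/
def InResAt (ω : ℝ × ℝ) (k k₁ k₂ k₃ : ℤ × ℤ) : Prop :=
  InRes ω k₁ k₂ k₃ k

/-- The box `Q_M = {k ∈ ℤ² : max(|k⁽¹⁾|, |k⁽²⁾|) ≤ M}`. -/
def QBox (M : ℤ) : Set (ℤ × ℤ) := {k : ℤ × ℤ | max |k.1| |k.2| ≤ M}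

/-- Two pairs with equal sums and equal sums of squares share their elements. -/
theorem eq_or_eq_of_add_eq_add_of_sq_add_sq_eq {R : Type*} [CommRing R] [IsDomain R] [CharZero R]
    {a b c d : R} (hs : a + b = c + d) (hq : a ^ 2 + b ^ 2 = c ^ 2 + d ^ 2) :
    d = a ∨ d = b := by
  have h : 2 * ((d - a) * (d - b)) = 0 := by
    linear_combination (a + b + c - d) * hs - hq
  rcases mul_eq_zero.mp ((mul_eq_zero.mp h).resolve_left two_ne_zero) with h | h
  · exact Or.inl (sub_eq_zero.mp h)
  · exact Or.inr (sub_eq_zero.mp h)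

/-- For irrational `ω`, the resonance condition decouples into the two coordinates. -/
theorem InRes.sq_add_sq_eq {ω : ℝ × ℝ} (hirr : IsIrrationalPair ω) {k₁ k₂ k₃ k₄ : ℤ × ℤ}
    (h : InRes ω k₁ k₂ k₃ k₄) :
    k₁.1 ^ 2 + k₂.1 ^ 2 = k₃.1 ^ 2 + k₄.1 ^ 2 ∧
      k₁.2 ^ 2 + k₂.2 ^ 2 = k₃.2 ^ 2 + k₄.2 ^ 2 := by
  have hm : ((k₁.1 ^ 2 + k₂.1 ^ 2 - (k₃.1 ^ 2 + k₄.1 ^ 2),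
      k₁.2 ^ 2 + k₂.2 ^ 2 - (k₃.2 ^ 2 + k₄.2 ^ 2)) : ℤ × ℤ) = 0 := by
    by_contra hne
    refine hirr _ hne ?_
    have hf := h.2
    simp only [freq] at hf
    push_cast
    linear_combination hf
  exact ⟨sub_eq_zero.mp (congrArg Prod.fst hm), sub_eq_zero.mp (congrArg Prod.snd hm)⟩

/-- For irrational `ω`, one of the first two elements of a resonance dominates the fourth in the
sup norm. -/
theorem InRes.max_abs_le {ω : ℝ × ℝ} (hirr : IsIrrationalPair ω) {k₁ k₂ k₃ k₄ : ℤ × ℤ}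
    (h : InRes ω k₁ k₂ k₃ k₄) :
    max |k₄.1| |k₄.2| ≤ max |k₁.1| |k₁.2| ∨ max |k₄.1| |k₄.2| ≤ max |k₂.1| |k₂.2| := by
  obtain ⟨hq₁, hq₂⟩ := h.sq_add_sq_eq hirr
  rcases max_choice |k₄.1| |k₄.2| with hk | hk <;> rw [hk]
  · rcases eq_or_eq_of_add_eq_add_of_sq_add_sq_eq (congrArg Prod.fst h.1) hq₁ with e | e <;> rw [e]
    · exact Or.inl (le_max_left _ _)
    · exact Or.inr (le_max_left _ _)
  · rcases eq_or_eq_of_add_eq_add_of_sq_add_sq_eq (congrArg Prod.snd h.1) hq₂ with e | e <;> rw [e]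
    · exact Or.inl (le_max_right _ _)
    · exact Or.inr (le_max_right _ _)

/-- For irrational `ω` and every `(k₁, k₂, k₃) ∈ R(k)` there is an index `i ∈ {1,2,3}`
with `max(|k_i⁽¹⁾|, |k_i⁽²⁾|) ≥ max(|k⁽¹⁾|, |k⁽²⁾|)`; in particular, if `k ∉ Q_M`
then the triple contains an element not belonging to `Q_M`. -/
theorem stmt_5 (ω : ℝ × ℝ) (hω1 : 0 < ω.1) (hω2 : 0 < ω.2)
    (hirr : IsIrrationalPair ω) (k k₁ k₂ k₃ : ℤ × ℤ)
    (h : InResAt ω k k₁ k₂ k₃) :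
    (∃ i : Fin 3,
      max |(![k₁, k₂, k₃] i).1| |(![k₁, k₂, k₃] i).2| ≥ max |k.1| |k.2|) ∧
    (∀ M : ℤ, 0 < M → k ∉ QBox M → ∃ i : Fin 3, (![k₁, k₂, k₃] i) ∉ QBox M) := by
  have hi : ∃ i : Fin 3,
      max |(![k₁, k₂, k₃] i).1| |(![k₁, k₂, k₃] i).2| ≥ max |k.1| |k.2| := by
    rcases InRes.max_abs_le hirr h with hle | hle
    · exact ⟨0, hle⟩
    · exact ⟨1, hle⟩
  refine ⟨hi, fun M _ hk => ?_⟩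
  obtain ⟨i, hle⟩ := hi
  exact ⟨i, fun hmem => hk (le_trans hle hmem)⟩
end

section
/- Let ω = (ω₁, ω₂) be irrational, let s > 1 be real, let N ≥ 1, and let Λ₁, …, Λ_N be finite pairwise disjoint subsets of ℤ². Call a nondegenerate element (n₁, n₂, n₃, n₄) of R with n₁, n₂ ∈ Λ_ℓ and n₃, n₄ ∈ Λ_{ℓ+1} a nuclear family at level ℓ. Assume that for every ℓ ∈ {1, …, N−1}: (existence and uniqueness of spouse and children) for every n₁ ∈ Λ_ℓ there is a nuclear family at level ℓ with n₁ as its first entry, and it is unique up to interchanging its third and fourth entries; (existence and uniqueness of sibling and parents) for every n₃ ∈ Λ_{ℓ+1} there is a nuclear family at level ℓ with n₃ as its third entry, and it is unique up to interchanging its first and second entries. Then for all j, k ∈ {1, …, N}: ∑_{n ∈ Λ_k} ((n⁽¹⁾)² + (n⁽²⁾)²)^s ≤ 2^s · ∑_{n ∈ Λ_j} ((n⁽¹⁾)² + (n⁽²⁾)²)^s. -/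
open Real

/-- A resonant 4-tuple is degenerate if `(k₃, k₄) = (k₁, k₂)` or `(k₃, k₄) = (k₂, k₁)`. -/
def Degenerate (k₁ k₂ k₃ k₄ : ℤ × ℤ) : Prop :=
  (k₃ = k₁ ∧ k₄ = k₂) ∨ (k₃ = k₂ ∧ k₄ = k₁)

/-- A nondegenerate element of the resonance set `R`. -/
def NDRes (ω : ℝ × ℝ) (k₁ k₂ k₃ k₄ : ℤ × ℤ) : Prop :=
  InRes ω k₁ k₂ k₃ k₄ ∧ ¬ Degenerate k₁ k₂ k₃ k₄

/-- A nuclear family at level `ℓ` for the generations `Λ`: a nondegenerate resonant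
4-tuple with parents in `Λ ℓ` and children in `Λ (ℓ+1)`. -/
def NuclearFamily (ω : ℝ × ℝ) (Λ : ℕ → Finset (ℤ × ℤ)) (ℓ : ℕ)
    (n₁ n₂ n₃ n₄ : ℤ × ℤ) : Prop :=
  NDRes ω n₁ n₂ n₃ n₄ ∧ n₁ ∈ Λ ℓ ∧ n₂ ∈ Λ ℓ ∧ n₃ ∈ Λ (ℓ + 1) ∧ n₄ ∈ Λ (ℓ + 1)

/-- A pair of integers is determined, up to order, by its sum and its sum of squares. -/
theorem Int.eq_and_eq_or_eq_and_eq_of_add_eq_of_sq_add_sq_eq {a b c d : ℤ}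
    (h : a + b = c + d) (h2 : a ^ 2 + b ^ 2 = c ^ 2 + d ^ 2) :
    (c = a ∧ d = b) ∨ (c = b ∧ d = a) := by
  obtain rfl : d = a + b - c := by omega
  have h0 : (c - a) * (c - b) = 0 := by linarith
  rcases mul_eq_zero.mp h0 with h | h <;> omega

/-- On an irrational torus, resonances decouple into the two coordinates. -/
theorem InRes.sq_add_sq_eq_s10 {ω : ℝ × ℝ} (hirr : IsIrrationalPair ω) {a b c d : ℤ × ℤ}
    (h : InRes ω a b c d) :
    a.1 ^ 2 + b.1 ^ 2 = c.1 ^ 2 + d.1 ^ 2 ∧ a.2 ^ 2 + b.2 ^ 2 = c.2 ^ 2 + d.2 ^ 2 := by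
  have hm : (a.1 ^ 2 + b.1 ^ 2 - c.1 ^ 2 - d.1 ^ 2,
      a.2 ^ 2 + b.2 ^ 2 - c.2 ^ 2 - d.2 ^ 2) = (0 : ℤ × ℤ) := by
    by_contra hne
    refine hirr _ hne ?_
    have hf := h.2
    simp only [freq] at hf
    push_cast
    linarith
  simp only [Prod.ext_iff, Prod.fst_zero, Prod.snd_zero] at hm
  constructor <;> linarith [hm.1, hm.2]

/-- The coordinate `p` takes two distinct values on each pair of parents, and the same two
values on their children. -/
def SplitsFamilies (ω : ℝ × ℝ) (p : ℤ × ℤ → ℤ) : Prop :=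
  ∀ a b c d, NDRes ω a b c d → p a ≠ p b ∧ ((p c = p a ∧ p d = p b) ∨ (p c = p b ∧ p d = p a))

theorem splitsFamilies_fst_and_snd {ω : ℝ × ℝ} (hirr : IsIrrationalPair ω) :
    SplitsFamilies ω Prod.fst ∧ SplitsFamilies ω Prod.snd := by
  have key : ∀ a b c d, NDRes ω a b c d →
      (a.1 ≠ b.1 ∧ ((c.1 = a.1 ∧ d.1 = b.1) ∨ (c.1 = b.1 ∧ d.1 = a.1))) ∧
      (a.2 ≠ b.2 ∧ ((c.2 = a.2 ∧ d.2 = b.2) ∨ (c.2 = b.2 ∧ d.2 = a.2))) := by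
    intro a b c d ⟨h, hnd⟩
    obtain ⟨q1, q2⟩ := h.sq_add_sq_eq_s10 hirr
    have h1 := Int.eq_and_eq_or_eq_and_eq_of_add_eq_of_sq_add_sq_eq (congrArg Prod.fst h.1) q1
    have h2 := Int.eq_and_eq_or_eq_and_eq_of_add_eq_of_sq_add_sq_eq (congrArg Prod.snd h.1) q2
    simp only [Degenerate, Prod.ext_iff] at hnd
    grind
  exact ⟨fun a b c d h => (key a b c d h).1, fun a b c d h => (key a b c d h).2⟩

theorem NDRes.swap_parents {ω : ℝ × ℝ} {a b c d : ℤ × ℤ} (h : NDRes ω a b c d) :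
    NDRes ω b a c d := by
  obtain ⟨⟨h1, h2⟩, h3⟩ := h
  exact ⟨⟨by rw [add_comm, h1], by rw [add_comm, h2]⟩, fun hd => h3 hd.symm⟩

theorem NDRes.swap_children {ω : ℝ × ℝ} {a b c d : ℤ × ℤ} (h : NDRes ω a b c d) :
    NDRes ω a b d c := by
  obtain ⟨⟨h1, h2⟩, h3⟩ := h
  exact ⟨⟨by rw [h1, add_comm], by rw [h2, add_comm]⟩,
    fun hd => h3 (hd.symm.imp And.symm And.symm)⟩

theorem NuclearFamily.swap_parents {ω : ℝ × ℝ} {Λ : ℕ → Finset (ℤ × ℤ)} {ℓ : ℕ}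
    {a b c d : ℤ × ℤ} (h : NuclearFamily ω Λ ℓ a b c d) : NuclearFamily ω Λ ℓ b a c d :=
  ⟨h.1.swap_parents, h.2.2.1, h.2.1, h.2.2.2.1, h.2.2.2.2⟩

theorem NuclearFamily.swap_children {ω : ℝ × ℝ} {Λ : ℕ → Finset (ℤ × ℤ)} {ℓ : ℕ}
    {a b c d : ℤ × ℤ} (h : NuclearFamily ω Λ ℓ a b c d) : NuclearFamily ω Λ ℓ a b d c :=
  ⟨h.1.swap_children, h.2.1, h.2.2.1, h.2.2.2.2, h.2.2.2.1⟩

/-- Sending each parent to its child with the same value of `p` is a bijection between consecutive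
generations, so sums of functions of `p` are preserved. -/
theorem sum_comp_eq_sum_comp_succ {ω : ℝ × ℝ} {Λ : ℕ → Finset (ℤ × ℤ)} {ℓ : ℕ}
    {p : ℤ × ℤ → ℤ} (hp : SplitsFamilies ω p)
    (hchild : ∀ n₁ ∈ Λ ℓ, ∃ n₂ n₃ n₄ : ℤ × ℤ,
      NuclearFamily ω Λ ℓ n₁ n₂ n₃ n₄ ∧
      ∀ n₂' n₃' n₄' : ℤ × ℤ, NuclearFamily ω Λ ℓ n₁ n₂' n₃' n₄' →
        n₂' = n₂ ∧ ((n₃' = n₃ ∧ n₄' = n₄) ∨ (n₃' = n₄ ∧ n₄' = n₃)))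
    (hparent : ∀ n₃ ∈ Λ (ℓ + 1), ∃ n₁ n₂ n₄ : ℤ × ℤ,
      NuclearFamily ω Λ ℓ n₁ n₂ n₃ n₄ ∧
      ∀ n₁' n₂' n₄' : ℤ × ℤ, NuclearFamily ω Λ ℓ n₁' n₂' n₃ n₄' →
        n₄' = n₄ ∧ ((n₁' = n₁ ∧ n₂' = n₂) ∨ (n₁' = n₂ ∧ n₂' = n₁)))
    (f : ℤ → ℝ) :
    ∑ n ∈ Λ ℓ, f (p n) = ∑ n ∈ Λ (ℓ + 1), f (p n) := by
  have hex : ∀ n ∈ Λ ℓ, ∃ m c d, NuclearFamily ω Λ ℓ n m c d ∧ p c = p n := by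
    intro n hn
    obtain ⟨m, c, d, hF, -⟩ := hchild n hn
    rcases (hp _ _ _ _ hF.1).2 with h | h
    · exact ⟨m, c, d, hF, h.1⟩
    · exact ⟨m, d, c, hF.swap_children, h.2⟩
  choose! m φ d hF hφ using hex
  refine Finset.sum_bij (fun n _ => φ n) (fun n hn => (hF n hn).2.2.2.1) ?_ ?_ ?_
  · intro n hn n' hn' heq
    obtain ⟨a, b, e, -, hu⟩ := hparent (φ n) (hF n hn).2.2.2.1
    have u := hu _ _ _ (hF n hn)
    have u' := hu _ _ _ (heq ▸ hF n' hn')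
    have hne := (hp _ _ _ _ (hF n hn).1).1
    have h1 := hφ n hn
    have h2 := hφ n' hn'
    grind
  · intro c hc
    obtain ⟨n, b, e, hG, hpc⟩ : ∃ n b e, NuclearFamily ω Λ ℓ n b c e ∧ p c = p n := by
      obtain ⟨a, b, e, hG, -⟩ := hparent c hc
      rcases (hp _ _ _ _ hG.1).2 with h | h
      · exact ⟨a, b, e, hG, h.1⟩
      · exact ⟨b, a, e, hG.swap_parents, h.1⟩
    have hn := hG.2.1
    refine ⟨n, hn, ?_⟩
    obtain ⟨b', c', e', -, hu⟩ := hchild n hn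
    have u := hu _ _ _ (hF n hn)
    have u' := hu _ _ _ hG
    have hs := hp _ _ _ _ hG.1
    have h1 := hφ n hn
    grind
  · intro n hn
    rw [hφ n hn]

/-- Real version of `NNReal.rpow_add_le_mul_rpow_add_rpow`. -/
theorem Real.rpow_add_le_mul_rpow_add_rpow {x y p : ℝ} (hx : 0 ≤ x) (hy : 0 ≤ y) (hp : 1 ≤ p) :
    (x + y) ^ p ≤ (2 : ℝ) ^ (p - 1) * (x ^ p + y ^ p) := by
  lift x to NNReal using hx
  lift y to NNReal using hy
  exact_mod_cast NNReal.rpow_add_le_mul_rpow_add_rpow x y hp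

/-- On an irrational torus, in a CKSTT-type construction with generations
`Λ₁, …, Λ_N` satisfying existence and uniqueness of spouse/children and of
sibling/parents, the weighted masses of any two generations are comparable:
`∑_{n ∈ Λ_k} (|n⁽¹⁾|² + |n⁽²⁾|²)^s ≤ 2^s ∑_{n ∈ Λ_j} (|n⁽¹⁾|² + |n⁽²⁾|²)^s`. -/
theorem stmt_10 (ω : ℝ × ℝ) (hω1 : 0 < ω.1) (hω2 : 0 < ω.2)
    (hirr : IsIrrationalPair ω) (s : ℝ) (hs : 1 < s) (N : ℕ) (hN : 1 ≤ N)
    (Λ : ℕ → Finset (ℤ × ℤ))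
    (hdisj : ∀ j k, 1 ≤ j → j ≤ N → 1 ≤ k → k ≤ N → j ≠ k → Disjoint (Λ j) (Λ k))
    (hchild : ∀ ℓ, 1 ≤ ℓ → ℓ + 1 ≤ N → ∀ n₁ ∈ Λ ℓ, ∃ n₂ n₃ n₄ : ℤ × ℤ,
      NuclearFamily ω Λ ℓ n₁ n₂ n₃ n₄ ∧
      ∀ n₂' n₃' n₄' : ℤ × ℤ, NuclearFamily ω Λ ℓ n₁ n₂' n₃' n₄' →
        n₂' = n₂ ∧ ((n₃' = n₃ ∧ n₄' = n₄) ∨ (n₃' = n₄ ∧ n₄' = n₃)))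
    (hparent : ∀ ℓ, 1 ≤ ℓ → ℓ + 1 ≤ N → ∀ n₃ ∈ Λ (ℓ + 1), ∃ n₁ n₂ n₄ : ℤ × ℤ,
      NuclearFamily ω Λ ℓ n₁ n₂ n₃ n₄ ∧
      ∀ n₁' n₂' n₄' : ℤ × ℤ, NuclearFamily ω Λ ℓ n₁' n₂' n₃ n₄' →
        n₄' = n₄ ∧ ((n₁' = n₁ ∧ n₂' = n₂) ∨ (n₁' = n₂ ∧ n₂' = n₁))) :
    ∀ j k, 1 ≤ j → j ≤ N → 1 ≤ k → k ≤ N →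
      ∑ n ∈ Λ k, (((n.1 : ℝ) ^ 2 + (n.2 : ℝ) ^ 2) ^ s) ≤
        (2 : ℝ) ^ s * ∑ n ∈ Λ j, (((n.1 : ℝ) ^ 2 + (n.2 : ℝ) ^ 2) ^ s) := by
  obtain ⟨hfst, hsnd⟩ := splitsFamilies_fst_and_snd hirr
  have hinv : ∀ k, 1 ≤ k → k ≤ N →
      (∑ n ∈ Λ k, ((n.1 : ℝ) ^ 2) ^ s = ∑ n ∈ Λ 1, ((n.1 : ℝ) ^ 2) ^ s) ∧
      (∑ n ∈ Λ k, ((n.2 : ℝ) ^ 2) ^ s = ∑ n ∈ Λ 1, ((n.2 : ℝ) ^ 2) ^ s) := by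
    intro k hk
    induction k, hk using Nat.le_induction with
    | base => exact fun _ => ⟨rfl, rfl⟩
    | succ k hk ih =>
      intro hkN
      obtain ⟨ih1, ih2⟩ := ih (by omega)
      rw [← ih1, ← ih2]
      exact ⟨(sum_comp_eq_sum_comp_succ hfst (hchild k hk hkN) (hparent k hk hkN)
          fun x : ℤ => ((x : ℝ) ^ 2) ^ s).symm,
        (sum_comp_eq_sum_comp_succ hsnd (hchild k hk hkN) (hparent k hk hkN)
          fun x : ℤ => ((x : ℝ) ^ 2) ^ s).symm⟩
  intro j k hj hjN hk hkN
  have hs1 : 1 ≤ s := hs.le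
  calc ∑ n ∈ Λ k, (((n.1 : ℝ) ^ 2 + (n.2 : ℝ) ^ 2) ^ s)
      ≤ ∑ n ∈ Λ k, (2 : ℝ) ^ (s - 1) * (((n.1 : ℝ) ^ 2) ^ s + ((n.2 : ℝ) ^ 2) ^ s) :=
        Finset.sum_le_sum fun n _ =>
          Real.rpow_add_le_mul_rpow_add_rpow (sq_nonneg _) (sq_nonneg _) hs1
    _ = (2 : ℝ) ^ (s - 1) * ∑ n ∈ Λ j, (((n.1 : ℝ) ^ 2) ^ s + ((n.2 : ℝ) ^ 2) ^ s) := by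
        rw [← Finset.mul_sum, Finset.sum_add_distrib, Finset.sum_add_distrib,
          (hinv k hk hkN).1, (hinv k hk hkN).2, (hinv j hj hjN).1, (hinv j hj hjN).2]
    _ ≤ (2 : ℝ) ^ s * ∑ n ∈ Λ j, (((n.1 : ℝ) ^ 2 + (n.2 : ℝ) ^ 2) ^ s) := by
        gcongr with n
        · norm_num
        · linarith
        · exact Real.add_rpow_le_rpow_add (sq_nonneg _) (sq_nonneg _) hs1
end
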